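/- In the homogeneous case with ν > 1, for every dominant state s ∈ 𝒟_C and every nonempty target set D ⊆ 𝒟_C \ {s}, the critical resistance satisfies the exact identity π_C(s)·Ψ(s,D) = C·N·ν^{Δ(s,D)}, where Ψ(s,D) := min over paths ω from s to D of max over consecutive pairs (x,y) in ω of r(x,y), with r(x,y) := (π_C(x) P(x,y))^{-1} and P(x,y) := (CN)^{-1} ν^{−max(a(x)−a(y),0)} for any CSMA step from x to y. -/

import Mathlib

open scoped Classical

noncomputable section

namespace CSMA

/-- An activity state of a multi-channel CSMA network with `N` nodes and `C` channels:
node `i` is inactive if `x i = 0` and active on channel `c` if `x i = c` (`1 ≤ c ≤ C`). -/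
abbrev CState (N C : ℕ) := Fin N → Fin (C + 1)

/-- Feasibility of an activity state: for every channel `c` and every edge of the conflict
graph `E c`, the two endpoints are not both active on channel `c`. -/
def Feasible {N C : ℕ} (E : Fin C → SimpleGraph (Fin N)) (x : CState N C) : Prop :=
  ∀ c : Fin C, ∀ i j : Fin N, (E c).Adj i j → ¬(x i = c.succ ∧ x j = c.succ)

/-- `a(x)`: the number of active nodes in state `x`. -/
def activeCount {N C : ℕ} (x : CState N C) : ℕ :=
  (Finset.univ.filter fun i => x i ≠ 0).card

/-- The finite set `𝒳_C` of feasible activity states. -/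
def FeasibleSet {N C : ℕ} (E : Fin C → SimpleGraph (Fin N)) : Finset (CState N C) :=
  Finset.univ.filter fun x => Feasible E x

/-- `𝒜(C)`: the maximum number of simultaneously active nodes over feasible states. -/
def maxActive {N C : ℕ} (E : Fin C → SimpleGraph (Fin N)) : ℕ :=
  (FeasibleSet E).sup activeCount

/-- `𝒟_C`: the set of dominant states, i.e. feasible states with `𝒜(C)` active nodes. -/
def DominantSet {N C : ℕ} (E : Fin C → SimpleGraph (Fin N)) : Finset (CState N C) :=
  (FeasibleSet E).filter fun x => activeCount x = maxActive E

/-- A single CSMA step: both states are feasible and `y` is obtained from `x` by either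
the activation of a single inactive node on some channel, or the deactivation of a single
active node (a node cannot change channel in a single step). -/
def Step {N C : ℕ} (E : Fin C → SimpleGraph (Fin N)) (x y : CState N C) : Prop :=
  Feasible E x ∧ Feasible E y ∧
    ∃ i : Fin N, (∀ j : Fin N, j ≠ i → y j = x j) ∧
      ((x i = 0 ∧ y i ≠ 0) ∨ (x i ≠ 0 ∧ y i = 0))

/-- `ω` is a path of CSMA steps from `x` to `y` inside the feasible state space. -/
def IsPath {N C : ℕ} (E : Fin C → SimpleGraph (Fin N)) (x y : CState N C)
    (ω : List (CState N C)) : Prop :=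
  ω.head? = some x ∧ ω.getLast? = some y ∧ (∀ z ∈ ω, Feasible E z) ∧ ω.Chain' (Step E)

/-- The height of a path: `max_{z ∈ ω} (𝒜(C) − a(z))`. -/
def pathHeight {N C : ℕ} (E : Fin C → SimpleGraph (Fin N)) (ω : List (CState N C)) : ℕ :=
  (ω.map fun z => maxActive E - activeCount z).foldr max 0

/-- The communication height `Δ(x,y) = min_{ω : x → y} max_{z ∈ ω} (𝒜(C) − a(z))`. -/
def commHeight {N C : ℕ} (E : Fin C → SimpleGraph (Fin N)) (x y : CState N C) : ℕ :=
  sInf {h : ℕ | ∃ ω, IsPath E x y ω ∧ pathHeight E ω = h}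

/-- The communication height `Δ(x,D)` between a state and a set of states. -/
def commHeightSet {N C : ℕ} (E : Fin C → SimpleGraph (Fin N)) (x : CState N C)
    (D : Set (CState N C)) : ℕ :=
  sInf {h : ℕ | ∃ ω y, y ∈ D ∧ IsPath E x y ω ∧ pathHeight E ω = h}

/-- `Γ(C)`: the worst communication height between a pair of dominant states. -/
def Gamma {N C : ℕ} (E : Fin C → SimpleGraph (Fin N)) : ℕ :=
  (DominantSet E).sup fun s => (DominantSet E).sup fun s' => commHeight E s s'

/-- The normalizing constant `Z(ν)` in the homogeneous case. -/
def Zhom {N C : ℕ} (E : Fin C → SimpleGraph (Fin N)) (ν : ℝ) : ℝ :=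
  ∑ y ∈ FeasibleSet E, ν ^ activeCount y

/-- The homogeneous stationary distribution `π_C(x) = ν^{a(x)} / Z(ν)`. -/
def piHom {N C : ℕ} (E : Fin C → SimpleGraph (Fin N)) (ν : ℝ) (x : CState N C) : ℝ :=
  ν ^ activeCount x / Zhom E ν


/-- The uniformized transition probability for a CSMA step from `x` to `y` in the
homogeneous case: `P(x,y) = (CN)⁻¹ ν^{−[a(x)−a(y)]⁺}` (the exponent `[a(x)−a(y)]⁺` is
the truncated natural subtraction `a(x) − a(y)`). -/
def stepProb {N C : ℕ} (ν : ℝ) (x y : CState N C) : ℝ :=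
  ((C : ℝ) * N)⁻¹ * (ν ^ (activeCount x - activeCount y))⁻¹

/-- The resistance `r(x,y) = (π_C(x) P(x,y))⁻¹` of a CSMA step from `x` to `y`. -/
def resistance {N C : ℕ} (E : Fin C → SimpleGraph (Fin N)) (ν : ℝ)
    (x y : CState N C) : ℝ :=
  (piHom E ν x * stepProb ν x y)⁻¹

/-- The resistance of a path: the maximum resistance over its consecutive pairs. -/
def pathResistance {N C : ℕ} (E : Fin C → SimpleGraph (Fin N)) (ν : ℝ)
    (ω : List (CState N C)) : ℝ :=
  ((ω.zip ω.tail).map fun p => resistance E ν p.1 p.2).foldr max 0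

/-- The critical resistance `Ψ(s,D) = min_{ω : s → D} max_{(x,y) ∈ ω} r(x,y)`, the inner
maximum being over consecutive pairs of the path `ω`. -/
def criticalResistance {N C : ℕ} (E : Fin C → SimpleGraph (Fin N)) (ν : ℝ)
    (s : CState N C) (D : Set (CState N C)) : ℝ :=
  sInf {r : ℝ | ∃ ω y, y ∈ D ∧ IsPath E s y ω ∧ pathResistance E ν ω = r}

theorem activeCount_le_maxActive {N C : ℕ} {E : Fin C → SimpleGraph (Fin N)}
    {x : CState N C} (hx : Feasible E x) : activeCount x ≤ maxActive E :=
  Finset.le_sup (f := activeCount) (Finset.mem_filter.2 ⟨Finset.mem_univ x, hx⟩)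

theorem Step.symm {N C : ℕ} {E : Fin C → SimpleGraph (Fin N)} {x y : CState N C}
    (h : Step E x y) : Step E y x := by
  obtain ⟨hx, hy, i, hne, hi⟩ := h
  exact ⟨hy, hx, i, fun j hj => (hne j hj).symm, by tauto⟩

theorem Feasible.update_zero {N C : ℕ} {E : Fin C → SimpleGraph (Fin N)} {x : CState N C}
    (hx : Feasible E x) (i : Fin N) : Feasible E (Function.update x i 0) := by
  have active : ∀ (c : Fin C) (j : Fin N), Function.update x i 0 j = c.succ → x j = c.succ := by
    intro c j h
    by_cases hj : j = i
    · subst hj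
      simp only [Function.update_self] at h
      exact absurd h.symm (Fin.succ_ne_zero c)
    · rwa [Function.update_of_ne hj] at h
  exact fun c j k hjk h => hx c j k hjk ⟨active c j h.1, active c k h.2⟩

theorem activeCount_update_zero_lt {N C : ℕ} {x : CState N C} {i : Fin N} (hi : x i ≠ 0) :
    activeCount (Function.update x i 0) < activeCount x := by
  refine Finset.card_lt_card (Finset.ssubset_iff_subset_ne.2 ⟨fun j hj => ?_, fun h => ?_⟩)
  · rw [Finset.mem_filter] at hj ⊢
    refine ⟨hj.1, fun h => hj.2 ?_⟩
    by_cases hji : j = i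
    · simp [hji]
    · rwa [Function.update_of_ne hji]
  · have : i ∈ Finset.univ.filter fun j => x j ≠ 0 := by simp [hi]
    rw [← h] at this
    simp at this

theorem reflTransGen_step_zero {N C : ℕ} {E : Fin C → SimpleGraph (Fin N)} {x : CState N C}
    (hx : Feasible E x) : Relation.ReflTransGen (Step E) x 0 := by
  induction hn : activeCount x using Nat.strong_induction_on generalizing x with
  | _ n ih =>
    by_cases h : x = 0
    · rw [h]
    · obtain ⟨i, hi⟩ := Function.ne_iff.1 h
      have hi : x i ≠ 0 := hi
      refine Relation.ReflTransGen.head ⟨hx, hx.update_zero i, i, fun j hj => ?_, ?_⟩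
        (ih _ (hn ▸ activeCount_update_zero_lt hi) (hx.update_zero i) rfl)
      · exact Function.update_of_ne hj _ _
      · exact Or.inr ⟨hi, by simp⟩

theorem exists_isPath {N C : ℕ} {E : Fin C → SimpleGraph (Fin N)} {x y : CState N C}
    (hx : Feasible E x) (hy : Feasible E y) : ∃ ω, IsPath E x y ω := by
  have : Std.Symm (Step E) := ⟨fun _ _ => Step.symm⟩
  have h : Relation.ReflTransGen (Step E) x y :=
    (reflTransGen_step_zero hx).trans
      (Relation.ReflTransGen.stdSymm.symm _ _ (reflTransGen_step_zero hy))
  induction h using Relation.ReflTransGen.head_induction_on with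
  | refl => exact ⟨[y], rfl, rfl, by simpa using hy, List.isChain_singleton y⟩
  | @head a b hab _ ih =>
    obtain ⟨ω, hhead, hlast, hfeas, hchain⟩ := ih hab.2.1
    obtain ⟨l, rfl⟩ := List.head?_eq_some_iff.1 hhead
    refine ⟨a :: b :: l, rfl, by simpa using hlast, ?_, ?_⟩
    · simpa [hx] using hfeas
    · exact List.isChain_cons_cons.2 ⟨hab, hchain⟩

theorem resistance_eq {N C : ℕ} {E : Fin C → SimpleGraph (Fin N)} {ν : ℝ} (hν : 0 < ν)
    {x y : CState N C} (hx : Feasible E x) (hy : Feasible E y) :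
    resistance E ν x y = (C : ℝ) * N * Zhom E ν / ν ^ maxActive E *
      ν ^ max (maxActive E - activeCount x) (maxActive E - activeCount y) := by
  have ha := activeCount_le_maxActive hx
  have hb := activeCount_le_maxActive hy
  have hexp : ν ^ (activeCount x - activeCount y) * ν ^ maxActive E =
      ν ^ max (maxActive E - activeCount x) (maxActive E - activeCount y) *
        ν ^ activeCount x := by
    rw [← pow_add, ← pow_add]
    congr 1
    omega
  simp only [resistance, piHom, stepProb, mul_inv, inv_inv, inv_div]
  have := hν.ne'
  field_simp
  linear_combination (C : ℝ) * N * Zhom E ν * hexp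

theorem pathResistance_eq {N C : ℕ} {E : Fin C → SimpleGraph (Fin N)} {ν : ℝ} (hν : 1 < ν)
    (l : List (CState N C)) (x y : CState N C) (h : ∀ z ∈ x :: y :: l, Feasible E z) :
    pathResistance E ν (x :: y :: l) =
      (C : ℝ) * N * Zhom E ν / ν ^ maxActive E * ν ^ pathHeight E (x :: y :: l) := by
  have hν0 : 0 < ν := zero_lt_one.trans hν
  have hK : 0 ≤ (C : ℝ) * N * Zhom E ν / ν ^ maxActive E := by
    have : 0 ≤ Zhom E ν := Finset.sum_nonneg fun _ _ => by positivity
    positivity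
  have hmono : Monotone fun n : ℕ => (C : ℝ) * N * Zhom E ν / ν ^ maxActive E * ν ^ n :=
    fun m n hmn => mul_le_mul_of_nonneg_left (pow_le_pow_right₀ hν.le hmn) hK
  have hr := resistance_eq hν0 (h x (by simp)) (h y (by simp))
  induction l generalizing x y with
  | nil =>
    have h0 : pathResistance E ν [x, y] = max (resistance E ν x y) 0 := rfl
    have h1 : pathHeight E [x, y] =
        max (maxActive E - activeCount x) (max (maxActive E - activeCount y) 0) := rfl
    rw [h0, h1, hr, Nat.max_zero, max_eq_left (by positivity)]
  | cons z l ih =>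
    have h' : ∀ w ∈ y :: z :: l, Feasible E w := fun w hw => h w (List.mem_cons_of_mem _ hw)
    have h0 : pathResistance E ν (x :: y :: z :: l) =
        max (resistance E ν x y) (pathResistance E ν (y :: z :: l)) := rfl
    have h1 : pathHeight E (x :: y :: z :: l) =
        max (maxActive E - activeCount x) (pathHeight E (y :: z :: l)) := rfl
    have h2 : maxActive E - activeCount y ≤ pathHeight E (y :: z :: l) := le_max_left _ _
    rw [h0, h1, hr, ih y z h' (resistance_eq hν0 (h' y (by simp)) (h' z (by simp))),
      ← hmono.map_max]
    congr 2
    omega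

theorem IsPath.pathResistance_eq {N C : ℕ} {E : Fin C → SimpleGraph (Fin N)} {ν : ℝ}
    (hν : 1 < ν) {x y : CState N C} (hxy : x ≠ y) {ω : List (CState N C)}
    (hω : IsPath E x y ω) :
    pathResistance E ν ω =
      (C : ℝ) * N * Zhom E ν / ν ^ maxActive E * ν ^ pathHeight E ω := by
  obtain ⟨hhead, hlast, hfeas, -⟩ := hω
  match ω, hhead, hlast, hfeas with
  | [_], hhead, hlast, _ =>
    exact absurd (Option.some.inj (hhead.symm.trans hlast)) hxy
  | a :: b :: l, _, _, hfeas => exact CSMA.pathResistance_eq hν l a b hfeas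

/-- In the homogeneous case with `ν > 1`, for every dominant state
`s ∈ 𝒟_C` and every nonempty target set `D ⊆ 𝒟_C \ {s}`, the critical resistance
satisfies the exact identity `π_C(s)·Ψ(s,D) = C·N·ν^{Δ(s,D)}`. -/
theorem critical_resistance_identity (N C : ℕ) (hN : 1 ≤ N) (hC : 1 ≤ C)
    (E : Fin C → SimpleGraph (Fin N)) (ν : ℝ) (hν : 1 < ν)
    (s : CState N C) (hs : s ∈ DominantSet E)
    (D : Set (CState N C)) (hD : D.Nonempty)
    (hDsub : D ⊆ {x | x ∈ DominantSet E} \ {s}) :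
    piHom E ν s * criticalResistance E ν s D =
      (C : ℝ) * N * ν ^ commHeightSet E s D := by
  have hsD := Finset.mem_filter.1 hs
  have hsF : Feasible E s := (Finset.mem_filter.1 hsD.1).2
  have hν0 : 0 < ν := zero_lt_one.trans hν
  have hZ : 0 < Zhom E ν := Finset.sum_pos (fun _ _ => by positivity) ⟨s, hsD.1⟩
  have hK : 0 ≤ (C : ℝ) * N * Zhom E ν / ν ^ maxActive E := by positivity
  have hne : ∀ y ∈ D, s ≠ y := fun y hy h => (hDsub hy).2 h.symm
  have hmem : commHeightSet E s D ∈
      {h : ℕ | ∃ ω y, y ∈ D ∧ IsPath E s y ω ∧ pathHeight E ω = h} := by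
    refine Nat.sInf_mem ?_
    obtain ⟨y, hy⟩ := hD
    obtain ⟨ω, hω⟩ := exists_isPath hsF
      (Finset.mem_filter.1 (Finset.mem_filter.1 (hDsub hy).1).1).2
    exact ⟨_, ω, y, hy, hω, rfl⟩
  have hleast : IsLeast {r : ℝ | ∃ ω y, y ∈ D ∧ IsPath E s y ω ∧ pathResistance E ν ω = r}
      ((C : ℝ) * N * Zhom E ν / ν ^ maxActive E * ν ^ commHeightSet E s D) := by
    refine ⟨?_, ?_⟩
    · obtain ⟨ω, y, hy, hω, hh⟩ := hmem
      exact ⟨ω, y, hy, hω, by rw [hω.pathResistance_eq hν (hne y hy), hh]⟩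
    · rintro r ⟨ω, y, hy, hω, rfl⟩
      rw [hω.pathResistance_eq hν (hne y hy)]
      exact mul_le_mul_of_nonneg_left
        (pow_le_pow_right₀ hν.le (Nat.sInf_le ⟨ω, y, hy, hω, rfl⟩)) hK
  rw [criticalResistance, hleast.csInf_eq, piHom, hsD.2]
  field_simp

end CSMA
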